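/- S-transformed Itô formula for the stochastic heat equation (deterministic core of the main theorem): let T > 0, let f : ℝ × ℝ → ℝ be smooth with compact support contained in (0,T) × (0,1), let m(v,x) := ∫₀ᵛ ∫₀¹ g_{v−s}(x,y)·f(s,y) dy ds (with m(0,x) := 0), let σ²(v,x) := ∫₀ᵛ ∫₀¹ g_{v−s}(x,y)² dy ds (with σ²(0,x) := 0), and let φ : ℝ → ℝ be twice continuously differentiable with φ, φ', φ'' bounded. Then for every t ∈ (0,T] and x ∈ (0,1): (P_{σ²(t,x)} φ)(m(t,x)) = φ(0) + ∫₀ᵗ (P_{σ²(v,x)} φ')(m(v,x))·( f(v,x) + (1/2)·∂²/∂x² m(v,x) ) dv + (1/2)·∫₀ᵗ (P_{σ²(v,x)} φ'')(m(v,x))·∂/∂v σ²(v,x) dv. -/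

import Mathlib

open Real MeasureTheory

/-- The Dirichlet heat kernel on `[0,1]`:
`g_t(x,y) = ∑_{n=1}^∞ 2 exp(−n²π²t/2) sin(nπx) sin(nπy)` (indexed here by `n+1`, `n : ℕ`). -/
noncomputable def heatKernel (t x y : ℝ) : ℝ :=
  ∑' n : ℕ, 2 * Real.exp (-(((n : ℝ) + 1) ^ 2 * π ^ 2 * t) / 2) *
    Real.sin (((n : ℝ) + 1) * π * x) * Real.sin (((n : ℝ) + 1) * π * y)

/-- The Gauss–Weierstrass (heat) semigroup:
`(P_t φ)(x) = ∫_ℝ φ(y) (2πt)^{−1/2} exp(−(x−y)²/(2t)) dy` for `t > 0`, and `P_0 φ = φ`. -/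
noncomputable def heatSemigroup (t : ℝ) (φ : ℝ → ℝ) (x : ℝ) : ℝ :=
  if 0 < t then
    ∫ y : ℝ, φ y * ((Real.sqrt (2 * π * t))⁻¹ * Real.exp (-(x - y) ^ 2 / (2 * t)))
  else φ x

/-- `m(v,x) := ∫₀ᵛ ∫₀¹ g_{v−s}(x,y) f(s,y) dy ds` (so `m(0,x) = 0`). -/
noncomputable def duhamel (f : ℝ × ℝ → ℝ) (v x : ℝ) : ℝ :=
  ∫ s in (0:ℝ)..v, ∫ y in (0:ℝ)..1, heatKernel (v - s) x y * f (s, y)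

/-- The variance of the solution of the stochastic heat equation:
`σ²(v,x) = ∫₀ᵛ ∫₀¹ g_{v−s}(x,y)² dy ds` (so `σ²(0,x) = 0`). -/
noncomputable def variance (v x : ℝ) : ℝ :=
  ∫ s in (0:ℝ)..v, ∫ y in (0:ℝ)..1, (heatKernel (v - s) x y) ^ 2

section GaussianAverage

open ProbabilityTheory

theorem heatSemigroup_eq_gaussian_average {t : ℝ} (ht : 0 ≤ t) (φ : ℝ → ℝ) (hφ : Continuous φ)
    (x : ℝ) : heatSemigroup t φ x = ∫ z, φ (x + √t * z) ∂gaussianReal 0 1 := by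
  rcases ht.eq_or_lt with rfl | ht'
  · simp [heatSemigroup]
  · have hmap : (gaussianReal 0 1).map (fun z => x + √t * z) = gaussianReal x t.toNNReal := by
      have : (fun z => x + √t * z) = (fun z => x + z) ∘ (fun z => √t * z) := rfl
      rw [this, ← Measure.map_map (by fun_prop) (by fun_prop), gaussianReal_map_const_mul,
        gaussianReal_map_const_add]
      congr 1
      · ring
      · ext; simp [Real.sq_sqrt ht, ht]
    rw [← integral_map (φ := fun z => x + √t * z) (f := φ) (by fun_prop)
      hφ.aestronglyMeasurable, hmap,
      integral_gaussianReal_eq_integral_smul (Real.toNNReal_pos.2 ht').ne']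
    simp only [heatSemigroup, if_pos ht', gaussianPDFReal_def, smul_eq_mul, Real.coe_toNNReal t ht]
    refine integral_congr_ae (.of_forall fun y => ?_)
    have : (x - y) ^ 2 = (y - x) ^ 2 := by ring
    simp only [this, mul_comm (φ y)]

theorem continuous_gaussian_average {ψ : ℝ → ℝ} (hψ : Continuous ψ) {C : ℝ}
    (hC : ∀ x, |ψ x| ≤ C) :
    Continuous fun p : ℝ × ℝ => ∫ z, ψ (p.1 + p.2 * z) ∂gaussianReal 0 1 := by
  refine continuous_of_dominated (bound := fun _ => C) (fun p => ?_) (fun p => ?_)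
    (integrable_const C) (.of_forall fun z => by fun_prop)
  · exact (by fun_prop : Continuous fun z => ψ (p.1 + p.2 * z)).aestronglyMeasurable
  · exact .of_forall fun z => hC _

theorem integrable_id_gaussianReal_std : Integrable (fun z : ℝ => z) (gaussianReal 0 1) :=
  memLp_one_iff_integrable.1 (memLp_id_gaussianReal 1)

theorem integrable_gaussian_comp_affine {ψ : ℝ → ℝ} (hψ : Continuous ψ) {C : ℝ}
    (hC : ∀ x, |ψ x| ≤ C) (a b : ℝ) :
    Integrable (fun z => ψ (a + b * z)) (gaussianReal 0 1) :=
  (integrable_const C).mono' (by fun_prop : Continuous _).aestronglyMeasurable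
    (.of_forall fun _ => hC _)

theorem integrable_gaussian_comp_affine_mul_id {ψ : ℝ → ℝ} (hψ : Continuous ψ) {C : ℝ}
    (hC : ∀ x, |ψ x| ≤ C) (a b : ℝ) :
    Integrable (fun z => ψ (a + b * z) * z) (gaussianReal 0 1) :=
  integrable_id_gaussianReal_std.bdd_mul (c := C)
    (by fun_prop : Continuous _).aestronglyMeasurable (.of_forall fun _ => hC _)

theorem hasDerivAt_gaussianPDFReal_std (z : ℝ) :
    HasDerivAt (gaussianPDFReal 0 1) (-z * gaussianPDFReal 0 1 z) z := by
  have h : HasDerivAt (fun z : ℝ => -(z - 0) ^ 2 / (2 * ((1 : NNReal) : ℝ))) (-z) z := by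
    have := (((hasDerivAt_id z).sub_const 0).pow 2).neg.div_const (2 * ((1 : NNReal) : ℝ))
    refine this.congr_deriv ?_
    simp
    ring
  have := h.exp.const_mul (√(2 * π * ((1 : NNReal) : ℝ)))⁻¹
  rw [gaussianPDFReal_def]
  refine this.congr_deriv ?_
  ring

/-- Gaussian integration by parts (Stein's identity). -/
theorem integral_gaussian_comp_affine_mul_id {ψ : ℝ → ℝ} (hψ : ContDiff ℝ 1 ψ) {C C' : ℝ}
    (hC : ∀ x, |ψ x| ≤ C) (hC' : ∀ x, |deriv ψ x| ≤ C') (a b : ℝ) :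
    ∫ z, ψ (a + b * z) * z ∂gaussianReal 0 1 =
      b * ∫ z, deriv ψ (a + b * z) ∂gaussianReal 0 1 := by
  have hint : ∀ {F : ℝ → ℝ}, Integrable F (gaussianReal 0 1) →
      Integrable fun z => F z * gaussianPDFReal 0 1 z := fun {F} hF => by
    rw [gaussianReal_of_var_ne_zero _ one_ne_zero,
      integrable_withDensity_iff_integrable_smul' (measurable_gaussianPDF _ _)
        (.of_forall fun _ => gaussianPDF_lt_top)] at hF
    simpa [toReal_gaussianPDF, mul_comm] using hF
  have hd : Continuous (deriv ψ) := hψ.continuous_deriv le_rfl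
  have h1 := hint (integrable_gaussian_comp_affine_mul_id hψ.continuous hC a b)
  have h2 := hint ((integrable_gaussian_comp_affine hd hC' a b).mul_const b)
  have h3 := hint (integrable_gaussian_comp_affine hψ.continuous hC a b)
  have key := integral_mul_deriv_eq_deriv_mul_of_integrable
    (u := fun z => ψ (a + b * z)) (v := gaussianPDFReal 0 1)
    (u' := fun z => deriv ψ (a + b * z) * b) (v' := fun z => -z * gaussianPDFReal 0 1 z)
    (fun z _ => by
      have := ((hψ.differentiable one_ne_zero (a + b * z)).hasDerivAt).comp z
        (((hasDerivAt_id z).const_mul b).const_add a)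
      simpa [Function.comp_def] using this)
    (fun z _ => hasDerivAt_gaussianPDFReal_std z)
    (by convert! h1.neg using 1; ext z; simp; ring) h2 h3
  rw [integral_gaussianReal_eq_integral_smul one_ne_zero,
    integral_gaussianReal_eq_integral_smul one_ne_zero, ← integral_const_mul]
  simp only [smul_eq_mul]
  rw [← neg_inj, ← integral_neg]
  convert key using 1
  · exact integral_congr_ae (.of_forall fun z => by ring)
  · congr 1; exact integral_congr_ae (.of_forall fun z => by ring)

theorem hasFDerivAt_gaussian_average {φ : ℝ → ℝ} (hφ : ContDiff ℝ 1 φ) {C C' : ℝ}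
    (hC : ∀ x, |φ x| ≤ C) (hC' : ∀ x, |deriv φ x| ≤ C') (p : ℝ × ℝ) :
    HasFDerivAt (fun p : ℝ × ℝ => ∫ z, φ (p.1 + p.2 * z) ∂gaussianReal 0 1)
      ((∫ z, deriv φ (p.1 + p.2 * z) ∂gaussianReal 0 1) • ContinuousLinearMap.fst ℝ ℝ ℝ +
        (∫ z, deriv φ (p.1 + p.2 * z) * z ∂gaussianReal 0 1) •
          ContinuousLinearMap.snd ℝ ℝ ℝ) p := by
  have hd : Continuous (deriv φ) := hφ.continuous_deriv le_rfl
  have hC0 : 0 ≤ C' := (abs_nonneg _).trans (hC' 0)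
  have h1 := integrable_gaussian_comp_affine hd hC' p.1 p.2
  have h2 := integrable_gaussian_comp_affine_mul_id hd hC' p.1 p.2
  have key := hasFDerivAt_integral_of_dominated_of_fderiv_le (𝕜 := ℝ)
    (μ := gaussianReal 0 1) (F := fun (p : ℝ × ℝ) z => φ (p.1 + p.2 * z)) (x₀ := p)
    (F' := fun p z => deriv φ (p.1 + p.2 * z) • ContinuousLinearMap.fst ℝ ℝ ℝ +
      (deriv φ (p.1 + p.2 * z) * z) • ContinuousLinearMap.snd ℝ ℝ ℝ)
    (bound := fun z => C' + C' * |z|) (s := Set.univ) Filter.univ_mem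
    (.of_forall fun q => by
      have := hφ.continuous
      exact (by fun_prop : Continuous fun z => φ (q.1 + q.2 * z)).aestronglyMeasurable)
    (integrable_gaussian_comp_affine hφ.continuous hC _ _)
    (by
      refine Continuous.aestronglyMeasurable ?_
      fun_prop)
    (.of_forall fun z q _ => by
      refine (norm_add_le _ _).trans (add_le_add ?_ ?_)
      · rw [norm_smul]
        exact (mul_le_mul (hC' _) (ContinuousLinearMap.norm_fst_le ℝ ℝ ℝ) (norm_nonneg _)
          hC0).trans_eq (mul_one _)
      · rw [norm_smul, norm_mul]
        refine (mul_le_mul (mul_le_mul_of_nonneg_right (hC' _) (norm_nonneg _))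
          (ContinuousLinearMap.norm_snd_le ℝ ℝ ℝ) (norm_nonneg _) ?_).trans_eq (mul_one _)
        exact mul_nonneg hC0 (norm_nonneg _))
    ((integrable_const _).add (integrable_id_gaussianReal_std.abs.const_mul _))
    (.of_forall fun z q _ => by
      have ha : HasFDerivAt (fun q : ℝ × ℝ => q.1 + q.2 * z)
          (ContinuousLinearMap.fst ℝ ℝ ℝ + z • ContinuousLinearMap.snd ℝ ℝ ℝ) q :=
        hasFDerivAt_fst.add (hasFDerivAt_snd.mul_const z)
      have := (hφ.differentiable one_ne_zero (q.1 + q.2 * z)).hasDerivAt.comp_hasFDerivAt q ha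
      refine this.congr_fderiv ?_
      rw [smul_add, smul_smul])
  refine key.congr_fderiv ?_
  rw [integral_add (h1.smul_const _) (h2.smul_const _), integral_smul_const, integral_smul_const]

/-- Chain rule along a differentiable curve of means and variances. -/
theorem hasDerivAt_heatSemigroup_comp {φ : ℝ → ℝ} (hφ : ContDiff ℝ 2 φ) {C C' C'' : ℝ}
    (hC : ∀ x, |φ x| ≤ C) (hC' : ∀ x, |deriv φ x| ≤ C') (hC'' : ∀ x, |deriv (deriv φ) x| ≤ C'')
    {q m : ℝ → ℝ} {q' m' v : ℝ} (hq : HasDerivAt q q' v) (hm : HasDerivAt m m' v)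
    (hpos : 0 < q v) :
    HasDerivAt (fun v => heatSemigroup (q v) φ (m v))
      (heatSemigroup (q v) (deriv φ) (m v) * m' +
        1 / 2 * (heatSemigroup (q v) (deriv (deriv φ)) (m v) * q')) v := by
  have hd : ContDiff ℝ 1 (deriv φ) := hφ.deriv'
  have hF := (hasFDerivAt_gaussian_average (hφ.of_le one_le_two) hC hC' (m v, √(q v)))
    |>.comp_hasDerivAt v (hm.prodMk (hq.sqrt hpos.ne'))
  have heq : (fun v => heatSemigroup (q v) φ (m v)) =ᶠ[nhds v]
      (fun p : ℝ × ℝ => ∫ z, φ (p.1 + p.2 * z) ∂gaussianReal 0 1) ∘ fun v => (m v, √(q v)) := by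
    filter_upwards [hq.continuousAt.eventually (lt_mem_nhds hpos)] with w hw
    exact heatSemigroup_eq_gaussian_average hw.le φ hφ.continuous _
  refine (hF.congr_of_eventuallyEq heq).congr_deriv ?_
  rw [heatSemigroup_eq_gaussian_average hpos.le _ hd.continuous,
    heatSemigroup_eq_gaussian_average hpos.le _ (hd.continuous_deriv le_rfl)]
  simp only [add_apply, smul_apply,
    ContinuousLinearMap.coe_fst', ContinuousLinearMap.coe_snd', smul_eq_mul]
  rw [integral_gaussian_comp_affine_mul_id hd hC' hC'']
  have : √(q v) ≠ 0 := (Real.sqrt_pos.2 hpos).ne'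
  field_simp

theorem continuousOn_heatSemigroup_comp {ψ : ℝ → ℝ} (hψ : Continuous ψ) {C : ℝ}
    (hC : ∀ x, |ψ x| ≤ C) {q m : ℝ → ℝ} {s : Set ℝ} (hq : ContinuousOn q s)
    (hm : ContinuousOn m s) (hpos : ∀ v ∈ s, 0 ≤ q v) :
    ContinuousOn (fun v => heatSemigroup (q v) ψ (m v)) s := by
  refine ((continuous_gaussian_average hψ hC).comp_continuousOn (hm.prodMk hq.sqrt)).congr ?_
  exact fun v hv => heatSemigroup_eq_gaussian_average (hpos v hv) ψ hψ _

end GaussianAverage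

/-- The Dirichlet eigenfunction `sin ((n + 1) π x)` on `[0, 1]`. -/
noncomputable def sineMode (n : ℕ) (x : ℝ) : ℝ := Real.sin (((n : ℝ) + 1) * π * x)

/-- The eigenvalue of `-(1/2) d²/dx²` associated with `sineMode n`. -/
noncomputable def sineEigenvalue (n : ℕ) : ℝ := (((n : ℝ) + 1) * π) ^ 2 / 2

/-- The sine coefficient of a function on `[0, 1]`. -/
noncomputable def sineCoeff (h : ℝ → ℝ) (n : ℕ) : ℝ := ∫ y in (0:ℝ)..1, sineMode n y * h y

theorem abs_sineMode_le (n : ℕ) (x : ℝ) : |sineMode n x| ≤ 1 := Real.abs_sin_le_one _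

@[fun_prop]
theorem continuous_sineMode (n : ℕ) : Continuous (sineMode n) := by
  unfold sineMode; fun_prop

theorem sineEigenvalue_pos (n : ℕ) : 0 < sineEigenvalue n := by
  unfold sineEigenvalue; positivity

theorem sq_le_sineEigenvalue (n : ℕ) : ((n : ℝ) + 1) ^ 2 ≤ sineEigenvalue n := by
  unfold sineEigenvalue
  have : 2 ≤ π ^ 2 := by nlinarith [Real.pi_gt_three]
  nlinarith [mul_le_mul_of_nonneg_left this (sq_nonneg ((n : ℝ) + 1))]

theorem summable_inv_sineEigenvalue : Summable fun n => (sineEigenvalue n)⁻¹ := by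
  have h := (summable_nat_add_iff 1).2 (Real.summable_nat_pow_inv.2 one_lt_two)
  refine h.of_nonneg_of_le (fun n => (inv_pos.2 (sineEigenvalue_pos n)).le) fun n => ?_
  have := sq_le_sineEigenvalue n
  push_cast
  gcongr

theorem summable_exp_neg_sineEigenvalue {t : ℝ} (ht : 0 < t) :
    Summable fun n => Real.exp (-(sineEigenvalue n * t)) := by
  refine (summable_inv_sineEigenvalue.mul_right t⁻¹).of_nonneg_of_le
    (fun n => (Real.exp_pos _).le) fun n => ?_
  rw [Real.exp_neg, ← mul_inv]
  have h := mul_pos (sineEigenvalue_pos n) ht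
  gcongr
  linarith [Real.add_one_le_exp (sineEigenvalue n * t)]

theorem heatKernel_eq_tsum (t x y : ℝ) :
    heatKernel t x y =
      ∑' n, 2 * Real.exp (-(sineEigenvalue n * t)) * sineMode n x * sineMode n y := by
  unfold heatKernel sineMode sineEigenvalue
  refine tsum_congr fun n => ?_
  congr 4
  ring

theorem abs_heatKernel_term_le (t x y : ℝ) (n : ℕ) :
    |2 * Real.exp (-(sineEigenvalue n * t)) * sineMode n x * sineMode n y| ≤
      2 * Real.exp (-(sineEigenvalue n * t)) := by
  rw [abs_mul, abs_mul, abs_of_pos (by positivity)]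
  have := abs_sineMode_le n x
  have := abs_sineMode_le n y
  calc _ ≤ 2 * Real.exp (-(sineEigenvalue n * t)) * 1 * 1 := by gcongr
    _ = _ := by ring

theorem summable_heatKernel {t : ℝ} (ht : 0 < t) (x y : ℝ) :
    Summable fun n => 2 * Real.exp (-(sineEigenvalue n * t)) * sineMode n x * sineMode n y :=
  .of_norm_bounded ((summable_exp_neg_sineEigenvalue ht).mul_left 2)
    fun n => abs_heatKernel_term_le t x y n

theorem continuous_heatKernel {t : ℝ} (ht : 0 < t) (x : ℝ) : Continuous (heatKernel t x) := by
  have : heatKernel t x = fun y => ∑' n, 2 * Real.exp (-(sineEigenvalue n * t)) * sineMode n x *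
      sineMode n y := funext fun y => heatKernel_eq_tsum t x y
  rw [this]
  exact continuous_tsum (fun n => by fun_prop)
    ((summable_exp_neg_sineEigenvalue ht).mul_left 2) fun n y => abs_heatKernel_term_le t x y n

theorem hasSum_integral_heatKernel_mul {t : ℝ} (ht : 0 < t) (x : ℝ) {h : ℝ → ℝ}
    (hh : Continuous h) :
    HasSum (fun n => 2 * Real.exp (-(sineEigenvalue n * t)) * sineMode n x * sineCoeff h n)
      (∫ y in (0:ℝ)..1, heatKernel t x y * h y) := by
  obtain ⟨C, hC⟩ := isCompact_uIcc.exists_bound_of_continuousOn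
    (hh.continuousOn (s := Set.uIcc (0:ℝ) 1))
  have hsum := (summable_exp_neg_sineEigenvalue ht).mul_left 2
  have := intervalIntegral.hasSum_integral_of_dominated_convergence (μ := volume)
    (a := 0) (b := 1) (f := fun y => heatKernel t x y * h y)
    (F := fun n y => 2 * Real.exp (-(sineEigenvalue n * t)) * sineMode n x * sineMode n y * h y)
    (fun n _ => 2 * Real.exp (-(sineEigenvalue n * t)) * C)
    (fun n => (by fun_prop : Continuous _).aestronglyMeasurable)
    (fun n => .of_forall fun y hy => by
      rw [norm_mul]
      exact mul_le_mul (abs_heatKernel_term_le t x y n) (hC y (Set.uIoc_subset_uIcc hy))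
        (norm_nonneg _) (by positivity))
    (.of_forall fun y _ => hsum.mul_right C)
    intervalIntegrable_const
    (.of_forall fun y _ => by
      rw [heatKernel_eq_tsum]
      exact (summable_heatKernel ht x y).hasSum.mul_right _)
  refine this.congr_fun fun n => ?_
  rw [sineCoeff, ← intervalIntegral.integral_const_mul]
  exact intervalIntegral.integral_congr fun y _ => by ring

theorem sineCoeff_sineMode (m n : ℕ) :
    sineCoeff (sineMode n) m = if m = n then 1 / 2 else 0 := by
  have hcos : ∀ k : ℤ, k ≠ 0 → ∫ y in (0:ℝ)..1, Real.cos ((k : ℝ) * π * y) = 0 := fun k hk => by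
    have hk' : (k : ℝ) * π ≠ 0 := mul_ne_zero (by exact_mod_cast hk) Real.pi_ne_zero
    rw [intervalIntegral.integral_comp_mul_left (fun y => Real.cos y) hk']
    simp [Real.sin_int_mul_pi]
  have hprod : ∀ y, sineMode m y * sineMode n y =
      1 / 2 * (Real.cos ((((m : ℤ) - n : ℤ) : ℝ) * π * y) -
        Real.cos ((((m : ℤ) + n + 2 : ℤ) : ℝ) * π * y)) := fun y => by
    have h1 := Real.cos_sub (((m : ℝ) + 1) * π * y) (((n : ℝ) + 1) * π * y)
    have h2 := Real.cos_add (((m : ℝ) + 1) * π * y) (((n : ℝ) + 1) * π * y)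
    have e1 : (((m : ℤ) - n : ℤ) : ℝ) * π * y =
        ((m : ℝ) + 1) * π * y - ((n : ℝ) + 1) * π * y := by push_cast; ring
    have e2 : (((m : ℤ) + n + 2 : ℤ) : ℝ) * π * y =
        ((m : ℝ) + 1) * π * y + ((n : ℝ) + 1) * π * y := by push_cast; ring
    rw [e1, e2, h1, h2, sineMode, sineMode]
    ring
  rw [sineCoeff, intervalIntegral.integral_congr fun y _ => hprod y,
    intervalIntegral.integral_const_mul, intervalIntegral.integral_sub
      (Continuous.intervalIntegrable (by fun_prop) _ _)
      (Continuous.intervalIntegrable (by fun_prop) _ _), hcos ((m : ℤ) + n + 2) (by omega)]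
  split_ifs with h
  · simp [h]
  · rw [hcos _ (by omega)]; simp

theorem sineCoeff_heatKernel {t : ℝ} (ht : 0 < t) (x : ℝ) (n : ℕ) :
    sineCoeff (heatKernel t x) n = Real.exp (-(sineEigenvalue n * t)) * sineMode n x := by
  have h := hasSum_integral_heatKernel_mul ht x (continuous_sineMode n)
  simp only [sineCoeff_sineMode] at h
  have h' := hasSum_ite_eq n (Real.exp (-(sineEigenvalue n * t)) * sineMode n x)
  have := h.unique (h'.congr_fun fun m => ?_)
  · rw [sineCoeff, ← this]
    exact intervalIntegral.integral_congr fun y _ => mul_comm _ _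
  · split_ifs with hm
    · subst hm; ring
    · ring

theorem integral_heatKernel_sq {t : ℝ} (ht : 0 < t) (x : ℝ) :
    ∫ y in (0:ℝ)..1, heatKernel t x y ^ 2 = heatKernel (2 * t) x x := by
  have h := hasSum_integral_heatKernel_mul ht x (continuous_heatKernel ht x)
  rw [heatKernel_eq_tsum, intervalIntegral.integral_congr fun y _ => sq (heatKernel t x y),
    ← h.tsum_eq]
  refine tsum_congr fun n => ?_
  rw [sineCoeff_heatKernel ht, show -(sineEigenvalue n * (2 * t)) =
    -(sineEigenvalue n * t) + -(sineEigenvalue n * t) by ring, Real.exp_add]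
  ring

theorem continuousOn_heatKernel_diag (x : ℝ) :
    ContinuousOn (fun t => heatKernel t x x) (Set.Ioi 0) := by
  intro t ht
  have ht2 : t / 2 < t := half_lt_self ht
  have : ContinuousOn (fun t => heatKernel t x x) (Set.Ioi (t / 2)) := by
    simp only [heatKernel_eq_tsum]
    refine continuousOn_tsum (fun n => by fun_prop)
      ((summable_exp_neg_sineEigenvalue (half_pos ht)).mul_left 2) fun n s hs => ?_
    refine (abs_heatKernel_term_le s x x n).trans ?_
    have := (sineEigenvalue_pos n).le
    have := (Set.mem_Ioi.1 hs).le
    gcongr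
  exact (this.continuousAt (Ioi_mem_nhds ht2)).continuousWithinAt

theorem heatKernel_diag_nonneg (t x : ℝ) : 0 ≤ heatKernel t x x := by
  rw [heatKernel_eq_tsum]
  refine tsum_nonneg fun n => ?_
  rw [mul_assoc _ (sineMode n x)]
  exact mul_nonneg (by positivity) (mul_self_nonneg _)

theorem heatKernel_diag_pos {t x : ℝ} (ht : 0 < t) (hx : x ∈ Set.Ioo (0:ℝ) 1) :
    0 < heatKernel t x x := by
  rw [heatKernel_eq_tsum]
  refine (summable_heatKernel ht x x).tsum_pos (fun n => ?_) 0 ?_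
  · rw [mul_assoc _ (sineMode n x)]
    exact mul_nonneg (by positivity) (mul_self_nonneg _)
  · have : 0 < sineMode 0 x := by
      refine Real.sin_pos_of_pos_of_lt_pi ?_ ?_
      · have := hx.1; positivity
      · have := mul_lt_mul_of_pos_left hx.2 Real.pi_pos
        simpa using this
    positivity

theorem heatKernel_diag_le {t : ℝ} (ht : 0 < t) (x : ℝ) :
    heatKernel t x x ≤ (2 * ∑' n : ℕ, (((n : ℝ) + 1) ^ (3 / 2 : ℝ))⁻¹) * t ^ (-3 / 4 : ℝ) := by
  have hs : Summable fun n : ℕ => (((n : ℝ) + 1) ^ (3 / 2 : ℝ))⁻¹ := by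
    have := (summable_nat_add_iff 1).2 (Real.summable_nat_rpow_inv.2 (by norm_num : (1:ℝ) < 3 / 2))
    simpa using this
  rw [heatKernel_eq_tsum, ← tsum_mul_left, ← tsum_mul_right]
  refine (summable_heatKernel ht x x).tsum_le_tsum (fun n => ?_) ((hs.mul_left 2).mul_right _)
  refine ((le_abs_self _).trans (abs_heatKernel_term_le t x x n)).trans ?_
  rw [mul_assoc]
  refine mul_le_mul_of_nonneg_left ?_ zero_le_two
  have hz : 0 < ((n : ℝ) + 1) ^ 2 * t := by positivity
  have h1 : Real.exp (-(sineEigenvalue n * t)) ≤ Real.exp (-(((n : ℝ) + 1) ^ 2 * t)) := by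
    have := sq_le_sineEigenvalue n
    gcongr
  refine h1.trans ?_
  have h2 : (((n : ℝ) + 1) ^ 2 * t) ^ (3 / 4 : ℝ) ≤ Real.exp (((n : ℝ) + 1) ^ 2 * t) := by
    set z := ((n : ℝ) + 1) ^ 2 * t
    calc z ^ (3 / 4 : ℝ) ≤ (1 + z) ^ (3 / 4 : ℝ) := by gcongr; linarith
      _ ≤ (1 + z) ^ (1 : ℝ) := Real.rpow_le_rpow_of_exponent_le (by linarith) (by norm_num)
      _ = z + 1 := by rw [Real.rpow_one, add_comm]
      _ ≤ _ := Real.add_one_le_exp z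
  rw [Real.exp_neg]
  calc _ ≤ ((((n : ℝ) + 1) ^ 2 * t) ^ (3 / 4 : ℝ))⁻¹ := by gcongr
    _ = _ := by
      rw [Real.mul_rpow (by positivity) ht.le, ← Real.rpow_natCast, ← Real.rpow_mul (by positivity),
        mul_inv, ← Real.rpow_neg ht.le]
      norm_num

theorem intervalIntegrable_heatKernel_diag (x : ℝ) {v : ℝ} (hv : 0 ≤ v) :
    IntervalIntegrable (fun s => heatKernel (2 * s) x x) volume 0 v := by
  have hm : Set.MapsTo (fun s : ℝ => 2 * s) (Set.Ioc 0 v) (Set.Ioi 0) := fun s hs => by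
    have := hs.1; simpa using this
  have hr : IntervalIntegrable (fun s : ℝ => (2 * ∑' n : ℕ, (((n : ℝ) + 1) ^ (3 / 2 : ℝ))⁻¹) *
      (2 * s) ^ (-3 / 4 : ℝ)) volume 0 v := by
    have := (intervalIntegral.intervalIntegrable_rpow' (a := 0) (b := 2 * v)
      (by norm_num : (-1 : ℝ) < -3 / 4)).comp_mul_left (c := 2)
    simpa using this.const_mul (2 * ∑' n : ℕ, (((n : ℝ) + 1) ^ (3 / 2 : ℝ))⁻¹)
  rw [intervalIntegrable_iff_integrableOn_Ioc_of_le hv] at hr ⊢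
  refine hr.mono' (((continuousOn_heatKernel_diag x).comp
    (by fun_prop) hm).aestronglyMeasurable measurableSet_Ioc) ?_
  refine (ae_restrict_iff' measurableSet_Ioc).2 (.of_forall fun s hs => ?_)
  rw [Real.norm_of_nonneg (heatKernel_diag_nonneg _ _)]
  exact heatKernel_diag_le (hm hs) x

theorem variance_eq_integral {v : ℝ} (hv : 0 ≤ v) (x : ℝ) :
    variance v x = ∫ s in (0:ℝ)..v, heatKernel (2 * s) x x := by
  have h := intervalIntegral.integral_comp_sub_left (fun s => heatKernel (2 * s) x x)
    (a := 0) (b := v) v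
  rw [sub_self, sub_zero] at h
  rw [← h, variance, intervalIntegral.integral_of_le hv, intervalIntegral.integral_of_le hv,
    ← restrict_Ioo_eq_restrict_Ioc]
  exact setIntegral_congr_fun measurableSet_Ioo fun s hs =>
    integral_heatKernel_sq (sub_pos.2 hs.2) x

theorem hasDerivAt_variance {v : ℝ} (hv : 0 < v) (x : ℝ) :
    HasDerivAt (fun v => variance v x) (heatKernel (2 * v) x x) v := by
  have hc : ContinuousOn (fun s => heatKernel (2 * s) x x) (Set.Ioi 0) :=
    (continuousOn_heatKernel_diag x).comp (by fun_prop) fun s (hs : 0 < s) => by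
      simpa using hs
  have h := intervalIntegral.integral_hasDerivAt_right
    (intervalIntegrable_heatKernel_diag x hv.le)
    (hc.stronglyMeasurableAtFilter isOpen_Ioi v hv) (hc.continuousAt (Ioi_mem_nhds hv))
  refine h.congr_of_eventuallyEq ?_
  filter_upwards [lt_mem_nhds hv] with w hw using variance_eq_integral hw.le x

theorem variance_pos {v x : ℝ} (hv : 0 < v) (hx : x ∈ Set.Ioo (0:ℝ) 1) : 0 < variance v x := by
  rw [variance_eq_integral hv.le]
  exact intervalIntegral.intervalIntegral_pos_of_pos_on
    (intervalIntegrable_heatKernel_diag x hv.le)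
    (fun s hs => heatKernel_diag_pos (mul_pos two_pos hs.1) hx) hv

theorem variance_zero (x : ℝ) : variance 0 x = 0 := by simp [variance]

theorem continuousOn_variance (x : ℝ) {t : ℝ} (ht : 0 ≤ t) :
    ContinuousOn (fun v => variance v x) (Set.Icc 0 t) := by
  have h := (intervalIntegrable_iff_integrableOn_Icc_of_le ht).1
    (intervalIntegrable_heatKernel_diag x ht)
  rw [← Set.uIcc_of_le ht] at h ⊢
  refine (intervalIntegral.continuousOn_primitive_interval h).congr fun v hv => ?_
  rw [Set.uIcc_of_le ht] at hv
  exact variance_eq_integral hv.1 x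

theorem hasDerivAt_sineMode (n : ℕ) (x : ℝ) :
    HasDerivAt (sineMode n) (((n : ℝ) + 1) * π * Real.cos (((n : ℝ) + 1) * π * x)) x := by
  refine (((hasDerivAt_id x).const_mul (((n : ℝ) + 1) * π)).sin).congr_deriv ?_
  simp
  ring

theorem hasDerivAt_sineMode_deriv (n : ℕ) (x : ℝ) :
    HasDerivAt (fun x => ((n : ℝ) + 1) * π * Real.cos (((n : ℝ) + 1) * π * x))
      (-(2 * sineEigenvalue n * sineMode n x)) x := by
  refine ((((hasDerivAt_id x).const_mul (((n : ℝ) + 1) * π)).cos).const_mul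
    (((n : ℝ) + 1) * π)).congr_deriv ?_
  simp only [sineEigenvalue, sineMode, id]
  ring

theorem sineMode_zero (n : ℕ) : sineMode n 0 = 0 := by simp [sineMode]

theorem sineMode_one (n : ℕ) : sineMode n 1 = 0 := by
  have := Real.sin_nat_mul_pi (n + 1)
  push_cast at this
  simpa [sineMode] using this

theorem abs_sineCoeff_le {h h' h'' : ℝ → ℝ} (hh : ∀ x, HasDerivAt h (h' x) x)
    (hh' : ∀ x, HasDerivAt h' (h'' x) x) (hc : Continuous h'') (h0 : h 0 = 0) (h1 : h 1 = 0)
    {C : ℝ} (hC : ∀ x, |h'' x| ≤ C) (n : ℕ) :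
    |sineCoeff h n| ≤ C * (sineEigenvalue n)⁻¹ := by
  have hcd : Continuous h' := continuous_iff_continuousAt.2 fun x => (hh' x).continuousAt
  have e1 := intervalIntegral.integral_mul_deriv_eq_deriv_mul (a := 0) (b := 1)
    (u := h) (v := fun x => ((n : ℝ) + 1) * π * Real.cos (((n : ℝ) + 1) * π * x))
    (fun x _ => hh x) (fun x _ => hasDerivAt_sineMode_deriv n x)
    (hcd.intervalIntegrable _ _) (Continuous.intervalIntegrable (by fun_prop) _ _)
  have e2 := intervalIntegral.integral_mul_deriv_eq_deriv_mul (a := 0) (b := 1)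
    (u := h') (v := sineMode n) (fun x _ => hh' x) (fun x _ => hasDerivAt_sineMode n x)
    (hc.intervalIntegrable _ _) (Continuous.intervalIntegrable (by fun_prop) _ _)
  rw [e2, h0, h1, sineMode_zero, sineMode_one] at e1
  have e3 : 2 * sineEigenvalue n * sineCoeff h n = -∫ x in (0:ℝ)..1, h'' x * sineMode n x := by
    have : ∫ x in (0:ℝ)..1, h x * -(2 * sineEigenvalue n * sineMode n x) =
        -(2 * sineEigenvalue n * sineCoeff h n) := by
      rw [sineCoeff, ← intervalIntegral.integral_const_mul, ← intervalIntegral.integral_neg]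
      exact intervalIntegral.integral_congr fun y _ => by ring
    linarith
  have e4 : |∫ x in (0:ℝ)..1, h'' x * sineMode n x| ≤ C := by
    have := intervalIntegral.norm_integral_le_of_norm_le_const (a := 0) (b := 1) (C := C)
      (f := fun x => h'' x * sineMode n x) fun x _ => by
        rw [norm_mul]
        exact (mul_le_mul (hC x) (abs_sineMode_le n x) (abs_nonneg _)
          ((abs_nonneg _).trans (hC x))).trans_eq (mul_one C)
    simpa using this
  have hpos := sineEigenvalue_pos n
  have e5 := congrArg abs e3
  rw [abs_neg, abs_mul, abs_of_pos (by positivity : 0 < 2 * sineEigenvalue n)] at e5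
  rw [← div_eq_mul_inv, le_div_iff₀ hpos]
  nlinarith [abs_nonneg (sineCoeff h n)]

theorem fourierCoeffOn_odd_extension {h : ℝ → ℝ} (hh : Continuous h) (n : ℤ) :
    fourierCoeffOn (by norm_num : (-1 : ℝ) < -1 + 2)
        (fun x => ((if 0 ≤ x then h x else -h (-x) : ℝ) : ℂ)) n =
      -Complex.I * ((∫ y in (0:ℝ)..1, Real.sin ((n : ℝ) * π * y) * h y : ℝ) : ℂ) := by
  set F : ℝ → ℂ := fun x => ((if 0 ≤ x then h x else -h (-x) : ℝ) : ℂ) with hF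
  set E : ℝ → ℂ := fun x => Complex.exp (-((n : ℂ) * π * x) * Complex.I) with hE
  have hEc : Continuous E := by fun_prop
  have hright : Set.EqOn (fun x => E x * F x) (fun x => E x * h x) (Set.Ioo 0 1) :=
    fun x hx => by simp [hF, hx.1.le]
  have hleft : Set.EqOn (fun x => E x * F x) (fun x => E x * -(h (-x) : ℂ)) (Set.Ioo (-1) 0) :=
    fun x hx => by simp [hF, not_le.2 hx.2]
  have hcr : Continuous fun x => E x * (h x : ℂ) := by fun_prop
  have hcl : Continuous fun x => E x * -(h (-x) : ℂ) := by fun_prop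
  have hir : IntervalIntegrable (fun x => E x * F x) volume 0 1 :=
    (hcr.intervalIntegrable 0 1).congr_uIoo (by rw [Set.uIoo_of_le zero_le_one]; exact hright.symm)
  have hil : IntervalIntegrable (fun x => E x * F x) volume (-1) 0 :=
    (hcl.intervalIntegrable (-1) 0).congr_uIoo
      (by rw [Set.uIoo_of_le (by norm_num)]; exact hleft.symm)
  have hreflect := intervalIntegral.integral_comp_neg (a := 0) (b := 1)
    fun x => E x * -(h (-x) : ℂ)
  have hsplit : ∫ x in (-1:ℝ)..(-1 + 2), E x * F x =
      ∫ x in (0:ℝ)..1, (E (-x) * -(h x : ℂ) + E x * h x) := by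
    rw [show (-1 + 2 : ℝ) = 1 by norm_num,
      ← intervalIntegral.integral_add_adjacent_intervals hil hir,
      intervalIntegral.integral_add (Continuous.intervalIntegrable (by fun_prop) _ _)
        (hcr.intervalIntegrable _ _),
      intervalIntegral.integral_congr_Ioo_of_le (by norm_num) hleft,
      intervalIntegral.integral_congr_Ioo_of_le zero_le_one hright]
    simpa using hreflect.symm
  rw [fourierCoeffOn_eq_integral]
  have hint : ∫ x in (-1:ℝ)..(-1 + 2), fourier (-n) (x : AddCircle (-1 + 2 - -1 : ℝ)) • F x =
      ∫ x in (-1:ℝ)..(-1 + 2), E x * F x := by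
    refine intervalIntegral.integral_congr fun x _ => ?_
    simp only [fourier_coe_apply, smul_eq_mul, hE]
    congr 2
    push_cast
    ring
  rw [hint, hsplit, ← intervalIntegral.integral_ofReal, ← intervalIntegral.integral_const_mul,
    ← intervalIntegral.integral_smul]
  refine intervalIntegral.integral_congr fun x _ => ?_
  have e := Complex.two_sin ((n : ℂ) * π * x)
  simp only [hE, Complex.real_smul]
  push_cast
  rw [show -((n : ℂ) * π * -(x : ℂ)) = n * π * x by ring]
  linear_combination (h x : ℂ) * (Complex.I / 2) * e + 1 / 2 * (h x : ℂ) *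
    (Complex.exp (-((n : ℂ) * π * x) * Complex.I) - Complex.exp ((n : ℂ) * π * x * Complex.I)) *
    Complex.I_sq

theorem hasSum_sineCoeff {h : ℝ → ℝ} (hh : Continuous h) (h0 : h 0 = 0) (h1 : h 1 = 0)
    (hs : Summable (sineCoeff h)) {x : ℝ} (hx : x ∈ Set.Ioo (0:ℝ) 1) :
    HasSum (fun n => 2 * sineCoeff h n * sineMode n x) (h x) := by
  have : Fact ((0:ℝ) < 2) := ⟨two_pos⟩
  set F : ℝ → ℂ := fun x => ((if 0 ≤ x then h x else -h (-x) : ℝ) : ℂ) with hF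
  set b : ℤ → ℝ := fun n => ∫ y in (0:ℝ)..1, Real.sin ((n : ℝ) * π * y) * h y with hb
  have hFc : Continuous F := by
    refine Complex.continuous_ofReal.comp
      (Continuous.if_le hh (by fun_prop) continuous_const continuous_id ?_)
    rintro x rfl
    simp [h0]
  have hlift : Continuous (AddCircle.liftIco 2 (-1) F) :=
    AddCircle.liftIco_continuous (by norm_num [hF, h1]) hFc.continuousOn
  have hcoeff : ∀ n, fourierCoeff (AddCircle.liftIco 2 (-1) F) n = -Complex.I * (b n : ℂ) :=
    fun n => by rw [fourierCoeff_liftIco_eq]; exact fourierCoeffOn_odd_extension hh n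
  have hbpos : ∀ n : ℕ, b ((n + 1 : ℕ) : ℤ) = sineCoeff h n := fun n => by
    simp [hb, sineCoeff, sineMode]
  have hbneg : ∀ n : ℤ, b (-n) = -b n := fun n => by
    simp [hb, ← intervalIntegral.integral_neg]
  have hbsum : Summable b := by
    have h1 : Summable fun n : ℕ => b n :=
      (summable_nat_add_iff 1).1 (by simpa only [hbpos] using hs)
    exact .of_nat_of_neg h1 (by simpa only [hbneg] using h1.neg)
  have key := has_pointwise_sum_fourier_series_of_summable
    (f := ⟨AddCircle.liftIco 2 (-1) F, hlift⟩)
    (by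
      rw [ContinuousMap.coe_mk, funext hcoeff]
      exact (Complex.hasSum_ofReal.2 hbsum.hasSum).summable.mul_left _) (x : AddCircle (2:ℝ))
  simp only [ContinuousMap.coe_mk, hcoeff] at key
  rw [AddCircle.liftIco_coe_apply (by constructor <;> linarith [hx.1, hx.2])] at key
  have key' := (hasSum_nat_add_iff' 1).2 key.nat_add_neg
  rw [← Complex.hasSum_ofReal]
  have hb0 : b 0 = 0 := by simp [hb]
  have hFx : F x = (h x : ℂ) := by simp [hF, hx.1.le]
  simp only [Finset.range_one, Finset.sum_singleton, hFx] at key'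
  simp only [Nat.cast_zero, neg_zero, hb0, Complex.ofReal_zero, mul_zero, zero_smul, add_zero,
    sub_zero] at key'
  refine key'.congr_fun fun n => ?_
  rw [hbneg, hbpos, fourier_coe_apply, fourier_coe_apply]
  have e := Complex.two_sin (((n : ℂ) + 1) * π * x)
  have e1 : 2 * (π : ℂ) * Complex.I * (((n + 1 : ℕ) : ℤ) : ℂ) * x / (2 : ℝ) =
      (((n : ℂ) + 1) * π * x) * Complex.I := by push_cast; ring
  have e2 : 2 * (π : ℂ) * Complex.I * ((-((n + 1 : ℕ) : ℤ) : ℤ) : ℂ) * x / (2 : ℝ) =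
      -(((n : ℂ) + 1) * π * x) * Complex.I := by push_cast; ring
  rw [e1, e2]
  simp only [sineMode, smul_eq_mul]
  push_cast
  linear_combination (sineCoeff h n : ℂ) * e

/-- The coefficient along `sineMode n` of the Duhamel convolution whose source has coefficient
`c`. -/
noncomputable def duhamelCoeff (c : ℝ → ℝ) (n : ℕ) (v : ℝ) : ℝ :=
  ∫ s in (0:ℝ)..v, 2 * Real.exp (-(sineEigenvalue n * (v - s))) * c s

theorem hasDerivAt_duhamelCoeff {c : ℝ → ℝ} (hc : Continuous c) (n : ℕ) (v : ℝ) :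
    HasDerivAt (duhamelCoeff c n) (2 * c v - sineEigenvalue n * duhamelCoeff c n v) v := by
  have heq : duhamelCoeff c n = fun v => Real.exp (-(sineEigenvalue n * v)) *
      ∫ s in (0:ℝ)..v, 2 * Real.exp (sineEigenvalue n * s) * c s := by
    funext v
    rw [duhamelCoeff, ← intervalIntegral.integral_const_mul]
    refine intervalIntegral.integral_congr fun s _ => ?_
    rw [show -(sineEigenvalue n * (v - s)) = -(sineEigenvalue n * v) + sineEigenvalue n * s by ring,
      Real.exp_add]
    ring
  have hcont : Continuous fun s => 2 * Real.exp (sineEigenvalue n * s) * c s := by fun_prop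
  have h1 := intervalIntegral.integral_hasDerivAt_right (hcont.intervalIntegrable 0 v)
    (hcont.stronglyMeasurableAtFilter _ _) hcont.continuousAt
  have h2 := ((hasDerivAt_id v).const_mul (sineEigenvalue n)).neg.exp
  rw [heq]
  refine (h2.mul h1).congr_deriv ?_
  have h3 : Real.exp (-(sineEigenvalue n * v)) * Real.exp (sineEigenvalue n * v) = 1 := by
    rw [← Real.exp_add]; simp
  simp only [id, Pi.neg_apply]
  linear_combination 2 * c v * h3

theorem abs_duhamelCoeff_le {c : ℝ → ℝ} {B : ℝ} (hB : ∀ s, |c s| ≤ B) (n : ℕ) {v : ℝ}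
    (hv : 0 ≤ v) : |duhamelCoeff c n v| ≤ 2 * B * (sineEigenvalue n)⁻¹ := by
  have hpos := sineEigenvalue_pos n
  have hB0 : 0 ≤ B := (abs_nonneg _).trans (hB 0)
  have hcont : Continuous fun s => 2 * Real.exp (-(sineEigenvalue n * (v - s))) * B := by fun_prop
  have hint : ∫ s in (0:ℝ)..v, 2 * Real.exp (-(sineEigenvalue n * (v - s))) * B =
      2 * B * (sineEigenvalue n)⁻¹ * (1 - Real.exp (-(sineEigenvalue n * v))) := by
    have hderiv : ∀ s, HasDerivAt
        (fun s => 2 * B * (sineEigenvalue n)⁻¹ * Real.exp (-(sineEigenvalue n * (v - s))))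
        (2 * Real.exp (-(sineEigenvalue n * (v - s))) * B) s := fun s => by
      refine ((((hasDerivAt_id s).const_sub v).const_mul
        (sineEigenvalue n)).neg.exp.const_mul _).congr_deriv ?_
      simp only [id, Pi.neg_apply]
      field_simp
    rw [intervalIntegral.integral_eq_sub_of_hasDerivAt (fun s _ => hderiv s)
      (hcont.intervalIntegrable _ _)]
    simp
    ring
  have h1 : |duhamelCoeff c n v| ≤ ∫ s in (0:ℝ)..v,
      2 * Real.exp (-(sineEigenvalue n * (v - s))) * B := by
    rw [← Real.norm_eq_abs, duhamelCoeff]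
    refine intervalIntegral.norm_integral_le_of_norm_le hv (.of_forall fun s _ => ?_)
      (hcont.intervalIntegrable _ _)
    rw [norm_mul, Real.norm_of_nonneg (by positivity)]
    exact mul_le_mul_of_nonneg_left (hB s) (by positivity)
  rw [hint] at h1
  refine h1.trans (mul_le_of_le_one_right (by positivity) ?_)
  linarith [Real.exp_pos (-(sineEigenvalue n * v))]

section Duhamel

variable {f : ℝ × ℝ → ℝ} {C : ℝ}

theorem continuous_sineCoeff_slice (hf : Continuous f) (n : ℕ) :
    Continuous fun s => sineCoeff (fun y => f (s, y)) n :=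
  intervalIntegral.continuous_parametric_intervalIntegral_of_continuous
    (f := fun s y => sineMode n y * f (s, y)) (by fun_prop) continuous_const

theorem sineEigenvalue_mul_abs_duhamelCoeff_le
    (hC : ∀ n s, |sineCoeff (fun y => f (s, y)) n| ≤ C * (sineEigenvalue n)⁻¹) (n : ℕ) {v : ℝ}
    (hv : 0 ≤ v) :
    sineEigenvalue n * |duhamelCoeff (fun s => sineCoeff (fun y => f (s, y)) n) n v| ≤
      2 * C * (sineEigenvalue n)⁻¹ := by
  have h := abs_duhamelCoeff_le (hC n) n hv
  have hpos := sineEigenvalue_pos n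
  calc _ ≤ sineEigenvalue n * (2 * (C * (sineEigenvalue n)⁻¹) * (sineEigenvalue n)⁻¹) := by gcongr
    _ = _ := by field_simp

theorem abs_duhamelCoeff_slice_le
    (hC : ∀ n s, |sineCoeff (fun y => f (s, y)) n| ≤ C * (sineEigenvalue n)⁻¹) (n : ℕ) {v : ℝ}
    (hv : 0 ≤ v) :
    |duhamelCoeff (fun s => sineCoeff (fun y => f (s, y)) n) n v| ≤
      2 * C * (sineEigenvalue n)⁻¹ := by
  refine le_trans ?_ (sineEigenvalue_mul_abs_duhamelCoeff_le hC n hv)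
  refine le_mul_of_one_le_left (abs_nonneg _) (le_trans ?_ (sq_le_sineEigenvalue n))
  exact one_le_pow₀ (by linarith [n.cast_nonneg (α := ℝ)])

theorem hasSum_duhamel (hf : Continuous f)
    (hC : ∀ n s, |sineCoeff (fun y => f (s, y)) n| ≤ C * (sineEigenvalue n)⁻¹) {v : ℝ}
    (hv : 0 ≤ v) (x : ℝ) :
    HasSum (fun n => duhamelCoeff (fun s => sineCoeff (fun y => f (s, y)) n) n v * sineMode n x)
      (duhamel f v x) := by
  have hsum : Summable fun n => 2 * (C * (sineEigenvalue n)⁻¹) :=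
    (summable_inv_sineEigenvalue.mul_left C).mul_left 2
  have hne : ∀ᵐ s : ℝ, s ≠ v := by simp [ae_iff]
  have := intervalIntegral.hasSum_integral_of_dominated_convergence (μ := volume)
    (a := 0) (b := v) (f := fun s => ∫ y in (0:ℝ)..1, heatKernel (v - s) x y * f (s, y))
    (F := fun n s => 2 * Real.exp (-(sineEigenvalue n * (v - s))) * sineMode n x *
      sineCoeff (fun y => f (s, y)) n)
    (fun n _ => 2 * (C * (sineEigenvalue n)⁻¹))
    (fun n => by
      have := continuous_sineCoeff_slice hf n
      exact (by fun_prop : Continuous _).aestronglyMeasurable)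
    (fun n => .of_forall fun s hs => by
      rw [Set.uIoc_of_le hv] at hs
      have h1 : Real.exp (-(sineEigenvalue n * (v - s))) ≤ 1 := by
        have := mul_nonneg (sineEigenvalue_pos n).le (sub_nonneg.2 hs.2)
        simpa using this
      have h2 := abs_sineMode_le n x
      have h3 := hC n s
      rw [Real.norm_eq_abs, abs_mul, abs_mul, abs_of_pos (by positivity)]
      calc _ ≤ 2 * 1 * 1 * (C * (sineEigenvalue n)⁻¹) := by gcongr
        _ = _ := by ring)
    (.of_forall fun s _ => hsum) intervalIntegrable_const
    (by
      filter_upwards [hne] with s hsv hs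
      rw [Set.uIoc_of_le hv] at hs
      exact hasSum_integral_heatKernel_mul (sub_pos.2 (lt_of_le_of_ne hs.2 hsv)) x
        (by fun_prop))
  refine this.congr_fun fun n => ?_
  rw [duhamelCoeff, ← intervalIntegral.integral_mul_const]
  exact intervalIntegral.integral_congr fun s _ => by ring

theorem deriv_deriv_duhamel (hf : Continuous f)
    (hC : ∀ n s, |sineCoeff (fun y => f (s, y)) n| ≤ C * (sineEigenvalue n)⁻¹) {v : ℝ}
    (hv : 0 ≤ v) (x : ℝ) :
    deriv (deriv fun x => duhamel f v x) x =
      ∑' n, -(2 * (sineEigenvalue n *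
        duhamelCoeff (fun s => sineCoeff (fun y => f (s, y)) n) n v) * sineMode n x) := by
  set a : ℕ → ℝ := fun n => duhamelCoeff (fun s => sineCoeff (fun y => f (s, y)) n) n v
  have ha : ∀ n, sineEigenvalue n * |a n| ≤ 2 * C * (sineEigenvalue n)⁻¹ := fun n =>
    sineEigenvalue_mul_abs_duhamelCoeff_le hC n hv
  have hsum : Summable fun n => 2 * (2 * C * (sineEigenvalue n)⁻¹) :=
    (summable_inv_sineEigenvalue.mul_left (2 * C)).mul_left 2
  have hk : ∀ n : ℕ, ((n : ℝ) + 1) * π ≤ 2 * sineEigenvalue n := fun n => by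
    have h1 : 1 ≤ ((n : ℝ) + 1) * π := by
      nlinarith [Real.pi_gt_three, n.cast_nonneg (α := ℝ)]
    unfold sineEigenvalue
    nlinarith
  have hd1 : ∀ n x, |a n * (((n : ℝ) + 1) * π * Real.cos (((n : ℝ) + 1) * π * x))| ≤
      2 * (2 * C * (sineEigenvalue n)⁻¹) := fun n x => by
    have h1 := Real.abs_cos_le_one (((n : ℝ) + 1) * π * x)
    have h2 := hk n
    have h3 := ha n
    rw [abs_mul, abs_mul, abs_of_pos (by positivity : 0 < ((n : ℝ) + 1) * π)]
    have := sineEigenvalue_pos n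
    calc _ ≤ |a n| * (2 * sineEigenvalue n * 1) := by gcongr
      _ ≤ _ := by linarith
  have hd2 : ∀ n x, |a n * -(2 * sineEigenvalue n * sineMode n x)| ≤
      2 * (2 * C * (sineEigenvalue n)⁻¹) := fun n x => by
    have h1 := abs_sineMode_le n x
    have h3 := ha n
    have := sineEigenvalue_pos n
    rw [abs_mul, abs_neg, abs_mul, abs_of_pos (by positivity : 0 < 2 * sineEigenvalue n)]
    calc _ ≤ |a n| * (2 * sineEigenvalue n * 1) := by gcongr
      _ ≤ _ := by linarith
  have e0 : (fun x => duhamel f v x) = fun x => ∑' n, a n * sineMode n x :=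
    funext fun x => (hasSum_duhamel hf hC hv x).tsum_eq.symm
  have e1 : deriv (fun x => duhamel f v x) =
      fun x => ∑' n, a n * (((n : ℝ) + 1) * π * Real.cos (((n : ℝ) + 1) * π * x)) := by
    funext x
    rw [e0]
    exact (hasDerivAt_tsum (y₀ := 0) hsum
      (fun n x => (hasDerivAt_sineMode n x).const_mul (a n)) hd1
      (hasSum_duhamel hf hC hv 0).summable x).deriv
  rw [e1, (hasDerivAt_tsum (y₀ := 0) hsum
    (fun n x => (hasDerivAt_sineMode_deriv n x).const_mul (a n)) hd2
    (.of_norm_bounded hsum fun n => hd1 n 0) x).deriv]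
  exact tsum_congr fun n => by ring

theorem continuousOn_duhamel (hf : Continuous f)
    (hC : ∀ n s, |sineCoeff (fun y => f (s, y)) n| ≤ C * (sineEigenvalue n)⁻¹) (x : ℝ) :
    ContinuousOn (fun v => duhamel f v x) (Set.Ici 0) := by
  have : ContinuousOn (fun v => ∑' n,
      duhamelCoeff (fun s => sineCoeff (fun y => f (s, y)) n) n v * sineMode n x) (Set.Ici 0) := by
    refine continuousOn_tsum (fun n => ?_) (summable_inv_sineEigenvalue.mul_left (2 * C))
      fun n v hv => ?_
    · exact ContinuousOn.mul_const (fun v _ => (hasDerivAt_duhamelCoeff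
        (continuous_sineCoeff_slice hf n) n v).continuousAt.continuousWithinAt) _
    · rw [norm_mul]
      exact (mul_le_of_le_one_right (norm_nonneg _) (abs_sineMode_le n x)).trans
        (abs_duhamelCoeff_slice_le hC n hv)
  exact this.congr fun v hv => (hasSum_duhamel hf hC hv x).tsum_eq.symm

theorem continuousOn_deriv_deriv_duhamel (hf : Continuous f)
    (hC : ∀ n s, |sineCoeff (fun y => f (s, y)) n| ≤ C * (sineEigenvalue n)⁻¹) (x : ℝ) :
    ContinuousOn (fun v => deriv (deriv fun x => duhamel f v x) x) (Set.Ici 0) := by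
  refine ContinuousOn.congr ?_ fun v hv => deriv_deriv_duhamel hf hC hv x
  refine continuousOn_tsum (fun n => ?_)
    ((summable_inv_sineEigenvalue.mul_left (2 * C)).mul_left 2) fun n v hv => ?_
  · have : Continuous (duhamelCoeff (fun s => sineCoeff (fun y => f (s, y)) n) n) :=
      continuous_iff_continuousAt.2 fun v =>
        (hasDerivAt_duhamelCoeff (continuous_sineCoeff_slice hf n) n v).continuousAt
    fun_prop
  · rw [norm_neg, norm_mul, norm_mul, norm_mul, Real.norm_of_nonneg (sineEigenvalue_pos n).le,
      Real.norm_two]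
    refine (mul_le_of_le_one_right (by have := sineEigenvalue_pos n; positivity)
      (abs_sineMode_le n x)).trans ?_
    exact mul_le_mul_of_nonneg_left (sineEigenvalue_mul_abs_duhamelCoeff_le hC n hv) zero_le_two

/-- The Duhamel convolution solves the inhomogeneous heat equation. -/
theorem hasDerivAt_duhamel (hf : Continuous f)
    (hC : ∀ n s, |sineCoeff (fun y => f (s, y)) n| ≤ C * (sineEigenvalue n)⁻¹)
    (h0 : ∀ s, f (s, 0) = 0) (h1 : ∀ s, f (s, 1) = 0) {v x : ℝ}
    (hv : 0 < v) (hx : x ∈ Set.Ioo (0:ℝ) 1) :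
    HasDerivAt (fun v => duhamel f v x)
      (f (v, x) + 1 / 2 * deriv (deriv fun x => duhamel f v x) x) v := by
  set c : ℕ → ℝ → ℝ := fun n s => sineCoeff (fun y => f (s, y)) n
  have hcoeff : ∀ n v, HasDerivAt (fun v => duhamelCoeff (c n) n v * sineMode n x)
      ((2 * c n v - sineEigenvalue n * duhamelCoeff (c n) n v) * sineMode n x) v := fun n v =>
    (hasDerivAt_duhamelCoeff (continuous_sineCoeff_slice hf n) n v).mul_const _
  have hsum := (summable_inv_sineEigenvalue.mul_left (2 * C)).mul_left 2
  have hbound : ∀ n, ∀ v ∈ Set.Ioi (0:ℝ),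
      ‖(2 * c n v - sineEigenvalue n * duhamelCoeff (c n) n v) * sineMode n x‖ ≤
        2 * (2 * C * (sineEigenvalue n)⁻¹) := fun n v hv => by
    rw [norm_mul]
    refine (mul_le_of_le_one_right (norm_nonneg _) (abs_sineMode_le n x)).trans ?_
    refine (norm_sub_le _ _).trans ?_
    rw [norm_mul, norm_mul, Real.norm_of_nonneg (sineEigenvalue_pos n).le, Real.norm_two,
      Real.norm_eq_abs, Real.norm_eq_abs]
    have e1 := hC n v
    have e2 := sineEigenvalue_mul_abs_duhamelCoeff_le hC n (Set.mem_Ioi.1 hv).le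
    linarith
  have key := hasDerivAt_tsum_of_isPreconnected hsum isOpen_Ioi isPreconnected_Ioi
    (fun n v _ => hcoeff n v) hbound hv (hasSum_duhamel hf hC hv.le x).summable hv
  have hcs : Summable (sineCoeff fun y => f (v, y)) :=
    .of_norm_bounded (summable_inv_sineEigenvalue.mul_left C) fun n => hC n v
  have hF := hasSum_sineCoeff (h := fun y => f (v, y)) (by fun_prop) (h0 v) (h1 v) hcs hx
  have hval : ∑' n, (2 * c n v - sineEigenvalue n * duhamelCoeff (c n) n v) * sineMode n x =
      f (v, x) + 1 / 2 * deriv (deriv fun x => duhamel f v x) x := by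
    have hs := Summable.of_norm_bounded hsum fun n => hbound n v hv
    rw [deriv_deriv_duhamel hf hC hv.le, ← hF.tsum_eq, ← tsum_mul_left,
      ← Summable.tsum_add hF.summable]
    · exact tsum_congr fun n => by ring
    · exact (hs.sub hF.summable).congr fun n => by ring
  rw [← hval]
  refine key.congr_of_eventuallyEq ?_
  filter_upwards [lt_mem_nhds hv] with w hw using (hasSum_duhamel hf hC hw.le x).tsum_eq.symm

end Duhamel

theorem exists_abs_sineCoeff_slice_le {f : ℝ × ℝ → ℝ} (hf : ContDiff ℝ 2 f)
    (hsupp : HasCompactSupport f) (h0 : ∀ s, f (s, 0) = 0) (h1 : ∀ s, f (s, 1) = 0) :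
    ∃ C, ∀ n s, |sineCoeff (fun y => f (s, y)) n| ≤ C * (sineEigenvalue n)⁻¹ := by
  have hd : ∀ {g : ℝ × ℝ → ℝ} {s : ℝ}, Differentiable ℝ g →
      ∀ y, HasDerivAt (fun y => g (s, y)) (fderiv ℝ g (s, y) (0, 1)) y := fun {g s} hg y =>
    (hg (s, y)).hasFDerivAt.comp_hasDerivAt y ((hasDerivAt_const y s).prodMk (hasDerivAt_id y))
  have hf1 : ContDiff ℝ 1 fun p => fderiv ℝ f p (0, 1) :=
    (hf.fderiv_right (m := 1) le_rfl).clm_apply contDiff_const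
  have hs1 : HasCompactSupport fun p => fderiv ℝ f p (0, 1) := hsupp.fderiv_apply ℝ _
  have hc2 : Continuous fun p => fderiv ℝ (fun p => fderiv ℝ f p (0, 1)) p (0, 1) :=
    (hf1.continuous_fderiv one_ne_zero).clm_apply continuous_const
  obtain ⟨C, hC⟩ := (hs1.fderiv_apply ℝ (0, 1)).exists_bound_of_continuous hc2
  exact ⟨C, fun n s => abs_sineCoeff_le (hd (hf.differentiable two_ne_zero))
    (hd (hf1.differentiable one_ne_zero)) (by fun_prop) (h0 s) (h1 s) (fun y => hC (s, y)) n⟩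

/-- S-transformed Itô formula for the stochastic heat equation (deterministic core of the main
theorem): for `f` smooth with compact support in `(0,T) × (0,1)`, `m` the Duhamel convolution,
`σ²` the variance function, and `φ` twice continuously differentiable with `φ, φ', φ''` bounded,
for all `t ∈ (0,T]` and `x ∈ (0,1)`:
`(P_{σ²(t,x)} φ)(m(t,x)) = φ(0) + ∫₀ᵗ (P_{σ²(v,x)} φ')(m(v,x))·(f(v,x) + ½ ∂²ₓ m(v,x)) dv
  + ½ ∫₀ᵗ (P_{σ²(v,x)} φ'')(m(v,x))·∂ᵥσ²(v,x) dv`. -/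
theorem s_transformed_ito_formula (T : ℝ) (hT : 0 < T) (f : ℝ × ℝ → ℝ)
    (hf : ContDiff ℝ (⊤ : ℕ∞) f) (hsupp : HasCompactSupport f)
    (hsub : tsupport f ⊆ Set.Ioo 0 T ×ˢ Set.Ioo (0:ℝ) 1)
    (φ : ℝ → ℝ) (hφ : ContDiff ℝ 2 φ)
    (hφb : ∃ C, ∀ x, |φ x| ≤ C) (hφb' : ∃ C, ∀ x, |deriv φ x| ≤ C)
    (hφb'' : ∃ C, ∀ x, |deriv (deriv φ) x| ≤ C) :
    ∀ t ∈ Set.Ioc 0 T, ∀ x ∈ Set.Ioo (0:ℝ) 1,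
      heatSemigroup (variance t x) φ (duhamel f t x) =
        φ 0 +
        (∫ v in (0:ℝ)..t,
          heatSemigroup (variance v x) (deriv φ) (duhamel f v x) *
            (f (v, x) + (1 / 2) * deriv (deriv fun x' => duhamel f v x') x)) +
        (1 / 2) * ∫ v in (0:ℝ)..t,
          heatSemigroup (variance v x) (deriv (deriv φ)) (duhamel f v x) *
            deriv (fun v' => variance v' x) v := by
  obtain ⟨C₀, hC₀⟩ := hφb
  obtain ⟨C₁, hC₁⟩ := hφb'
  obtain ⟨C₂, hC₂⟩ := hφb''
  intro t ht x hx
  have hzero : ∀ s y, y ∉ Set.Ioo (0:ℝ) 1 → f (s, y) = 0 := fun s y hy =>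
    image_eq_zero_of_notMem_tsupport fun h => hy (hsub h).2
  have h0 : ∀ s, f (s, 0) = 0 := fun s => hzero s 0 (by simp)
  have h1 : ∀ s, f (s, 1) = 0 := fun s => hzero s 1 (by simp)
  obtain ⟨C, hC⟩ := exists_abs_sineCoeff_slice_le (contDiff_infty.1 hf 2) hsupp h0 h1
  have hd : ContDiff ℝ 1 (deriv φ) := hφ.deriv'
  have hq := continuousOn_variance x ht.1.le
  have hq0 : ∀ v ∈ Set.Icc 0 t, 0 ≤ variance v x := fun v hv => by
    rcases hv.1.eq_or_lt with rfl | hv'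
    · exact (variance_zero x).ge
    · exact (variance_pos hv' hx).le
  have hsubset : Set.Icc 0 t ⊆ Set.Ici 0 := fun v hv => hv.1
  have hm := (continuousOn_duhamel hf.continuous hC x).mono hsubset
  have hA : IntervalIntegrable (fun v => heatSemigroup (variance v x) (deriv φ) (duhamel f v x) *
      (f (v, x) + 1 / 2 * deriv (deriv fun x' => duhamel f v x') x)) volume 0 t := by
    refine ContinuousOn.intervalIntegrable ?_
    rw [Set.uIcc_of_le ht.1.le]
    have hfc := hf.continuous
    refine (continuousOn_heatSemigroup_comp hd.continuous hC₁ hq hm hq0).mul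
      (ContinuousOn.add (by fun_prop) (continuousOn_const.mul ?_))
    exact (continuousOn_deriv_deriv_duhamel hf.continuous hC x).mono hsubset
  have hB : IntervalIntegrable (fun v => heatSemigroup (variance v x) (deriv (deriv φ))
      (duhamel f v x) * deriv (fun v' => variance v' x) v) volume 0 t := by
    have hcont := continuousOn_heatSemigroup_comp (hd.continuous_deriv le_rfl) hC₂ hq hm hq0
    rw [← Set.uIcc_of_le ht.1.le] at hcont
    refine ((intervalIntegrable_heatKernel_diag x ht.1.le).continuousOn_mul hcont).congr_uIoo ?_
    rw [Set.uIoo_of_le ht.1.le]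
    exact fun v hv => by simp only [(hasDerivAt_variance hv.1 x).deriv]
  have key := intervalIntegral.integral_eq_sub_of_hasDerivAt_of_le ht.1.le
    (continuousOn_heatSemigroup_comp hφ.continuous hC₀ hq hm hq0)
    (fun v hv => by
      have hvar := hasDerivAt_variance hv.1 x
      rw [← hvar.deriv] at hvar
      exact hasDerivAt_heatSemigroup_comp hφ hC₀ hC₁ hC₂ hvar
        (hasDerivAt_duhamel hf.continuous hC h0 h1 hv.1 hx) (variance_pos hv.1 hx))
    (hA.add (hB.const_mul (1 / 2)))
  have hzero_value : heatSemigroup (variance 0 x) φ (duhamel f 0 x) = φ 0 := by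
    simp [variance_zero, heatSemigroup, duhamel]
  rw [intervalIntegral.integral_add hA (hB.const_mul _), intervalIntegral.integral_const_mul,
    hzero_value] at key
  linarith
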